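/- arXiv:2204.04032 — 7 statements merged into one kernel-verified Lean document; each statement's English description precedes it below -/
import Mathlib

section
/- Let A : ℝ → Matrix (Fin m) (Fin m) ℂ be continuous with A(x)ᴴ = −A(x) for all x, and let P : ℝ → Matrix (Fin m) (Fin m) ℂ satisfy P'(x) = −A(x) P(x) for all x and P(x₀) = 1. Then P(x) is unitary for every x ∈ ℝ, i.e. P(x)ᴴ P(x) = 1. -/
open Matrix

attribute [local instance] Matrix.normedAddCommGroup Matrix.normedSpace

theorem Matrix.hasDerivAt_iff {m n : Type*} [Fintype m] [Fintype n]
    {P : ℝ → Matrix m n ℂ} {P' : Matrix m n ℂ} {x : ℝ} :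
    HasDerivAt P P' x ↔ ∀ i j, HasDerivAt (fun t => P t i j) (P' i j) x := by
  refine Iff.trans (hasDerivAt_pi (φ := fun t => (P t : m → n → ℂ))) ?_
  exact forall_congr' fun i => hasDerivAt_pi

/-- The product rule for the Gram matrix `Pᴴ * P` of a matrix-valued function. -/
theorem Matrix.hasDerivAt_conjTranspose_mul_self {m n : Type*} [Fintype m] [Fintype n]
    {P : ℝ → Matrix m n ℂ} {P' : Matrix m n ℂ} {x : ℝ} (h : HasDerivAt P P' x) :
    HasDerivAt (fun t => (P t)ᴴ * P t) (P'ᴴ * P x + (P x)ᴴ * P') x := by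
  rw [Matrix.hasDerivAt_iff] at h ⊢
  intro i j
  simp only [Matrix.add_apply, Matrix.mul_apply, Matrix.conjTranspose_apply,
    ← Finset.sum_add_distrib]
  exact HasDerivAt.fun_sum fun k _ => (h k i).star.mul (h k j)

/-- If `A` is a continuous anti-hermitian matrix-valued function and `P` solves the parallel
transport equation `P' = -A P` with `P x₀ = 1`, then `P x` is unitary for every `x`. -/
theorem parallel_transport_unitary {m : ℕ}
    (A P : ℝ → Matrix (Fin m) (Fin m) ℂ)
    (hA : Continuous A)
    (hAanti : ∀ x : ℝ, (A x)ᴴ = -A x)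
    (x₀ : ℝ)
    (hP : ∀ x : ℝ, HasDerivAt P (-(A x) * P x) x)
    (hP₀ : P x₀ = 1)
    (x : ℝ) :
    (P x)ᴴ * P x = 1 := by
  have hderiv : ∀ t, HasDerivAt (fun s => (P s)ᴴ * P s) 0 t := fun t => by
    convert Matrix.hasDerivAt_conjTranspose_mul_self (hP t) using 1
    rw [Matrix.conjTranspose_mul, Matrix.conjTranspose_neg, hAanti, neg_neg, Matrix.neg_mul,
      Matrix.mul_neg, Matrix.mul_assoc, add_neg_cancel]
  have hconst := is_const_of_deriv_eq_zero (fun t => (hderiv t).differentiableAt)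
    (fun t => (hderiv t).deriv) x x₀
  simpa [hP₀] using hconst
end

section
/- Let A : ℝ → Matrix (Fin m) (Fin m) ℂ be continuous with A(x)ᴴ = −A(x) for all x, let P : ℝ → Matrix (Fin m) (Fin m) ℂ satisfy P'(x) = −A(x) P(x) and P(x₀) = 1, and define the parallel transport operators Ω(b,a) = P(b) P(a)⁻¹. Then for all a, b ∈ ℝ one has Ω(b,a)ᴴ = Ω(a,b). -/
open Matrix

attribute [local instance] Matrix.normedAddCommGroup Matrix.normedSpace

/-- A differentiable curve of matrices has differentiable entries. -/
theorem HasDerivAt.matrix_apply {m n : ℕ} {P : ℝ → Matrix (Fin m) (Fin n) ℂ}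
    {P' : Matrix (Fin m) (Fin n) ℂ} {x : ℝ} (h : HasDerivAt P P' x) (i : Fin m) (j : Fin n) :
    HasDerivAt (fun t => P t i j) (P' i j) x :=
  hasDerivAt_pi.1 (hasDerivAt_pi.1 h i) j

/-- Along a solution of `P' = -A P` with `A` anti-hermitian, the Gram matrix `Pᴴ P` is constant. -/
theorem conjTranspose_mul_self_eq_of_hasDerivAt {m n : ℕ}
    {A : ℝ → Matrix (Fin m) (Fin m) ℂ} {P : ℝ → Matrix (Fin m) (Fin n) ℂ}
    (hA : ∀ x, (A x)ᴴ = -A x) (hP : ∀ x, HasDerivAt P (-(A x) * P x) x) (x y : ℝ) :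
    (P x)ᴴ * P x = (P y)ᴴ * P y := by
  ext i j
  have hderiv (t : ℝ) : HasDerivAt (fun t => ((P t)ᴴ * P t) i j) 0 t := by
    have hsum : HasDerivAt (fun t => ∑ k, star (P t k i) * P t k j)
        (∑ k, (star ((-(A t) * P t) k i) * P t k j
          + star (P t k i) * (-(A t) * P t) k j)) t :=
      HasDerivAt.fun_sum fun k _ =>
        ((hP t).matrix_apply k i).star.mul ((hP t).matrix_apply k j)
    have hzero : (-(A t) * P t)ᴴ * P t + (P t)ᴴ * (-(A t) * P t) = 0 := by
      simp [conjTranspose_mul, hA, Matrix.mul_assoc]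
    have hentry := congrFun (congrFun hzero i) j
    rw [Finset.sum_add_distrib] at hsum
    simp only [Matrix.add_apply, Matrix.mul_apply (M := (_)ᴴ), conjTranspose_apply,
      Matrix.zero_apply] at hentry
    rw [hentry] at hsum
    simpa only [Matrix.mul_apply, conjTranspose_apply] using hsum
  exact is_const_of_deriv_eq_zero (fun t => (hderiv t).differentiableAt)
    (fun t => (hderiv t).deriv) x y

/-- If `A` is continuous and anti-hermitian and `P` solves `P' = -A P`, `P x₀ = 1`, then the
parallel transport operators `Ω(b,a) = P(b) P(a)⁻¹` satisfy `Ω(b,a)ᴴ = Ω(a,b)`. -/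
theorem parallel_transport_conjTranspose {m : ℕ}
    (A P : ℝ → Matrix (Fin m) (Fin m) ℂ)
    (hA : Continuous A)
    (hAanti : ∀ x : ℝ, (A x)ᴴ = -A x)
    (x₀ : ℝ)
    (hP : ∀ x : ℝ, HasDerivAt P (-(A x) * P x) x)
    (hP₀ : P x₀ = 1)
    (Ω : ℝ → ℝ → Matrix (Fin m) (Fin m) ℂ)
    (hΩ : ∀ b a : ℝ, Ω b a = P b * (P a)⁻¹)
    (a b : ℝ) :
    (Ω b a)ᴴ = Ω a b := by
  have hunitary (x : ℝ) : (P x)ᴴ * P x = 1 := by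
    rw [conjTranspose_mul_self_eq_of_hasDerivAt hAanti hP x x₀, hP₀]
    simp
  have hinv (x : ℝ) : (P x)⁻¹ = (P x)ᴴ := Matrix.inv_eq_left_inv (hunitary x)
  rw [hΩ, hΩ, hinv, hinv, conjTranspose_mul, conjTranspose_conjTranspose]
end

section
/- Let A : ℝ → Matrix (Fin m) (Fin m) ℂ be continuous and let g : ℝ → Matrix (Fin m) (Fin m) ℂ be differentiable with g(x)ᴴ g(x) = 1 for all x (a gauge transformation). Define the gauge-transformed connection matrix Ã(x) = g(x)ᴴ A(x) g(x) + g(x)ᴴ g'(x). If P satisfies P'(x) = −A(x) P(x) with P(a) = 1, and P̃ satisfies P̃'(x) = −Ã(x) P̃(x) with P̃(a) = 1, then P̃(x) = g(x)ᴴ P(x) g(a) for all x ∈ ℝ. In particular the parallel transport operators transform as Ω̃(b,a) = g(b)ᴴ Ω(b,a) g(a). -/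
open Matrix

attribute [local instance] Matrix.normedAddCommGroup Matrix.normedSpace

/-- Solutions of a linear ODE `f' = L f` with continuous coefficients are determined by one
value. -/
theorem linear_ode_unique {E : Type*} [NormedAddCommGroup E] [NormedSpace ℝ E]
    {L : ℝ → E →L[ℝ] E} (hL : Continuous L) {f₁ f₂ : ℝ → E} {a : ℝ}
    (h₁ : ∀ t, HasDerivAt f₁ (L t (f₁ t)) t) (h₂ : ∀ t, HasDerivAt f₂ (L t (f₂ t)) t)
    (ha : f₁ a = f₂ a) (x : ℝ) : f₁ x = f₂ x := by
  obtain ⟨l, r, hx, har⟩ : ∃ l r, x ∈ Set.Ioo l r ∧ a ∈ Set.Ioo l r :=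
    ⟨min x a - 1, max x a + 1, by grind, by grind⟩
  obtain ⟨C, hC⟩ := (isCompact_Icc (a := l) (b := r)).exists_bound_of_continuousOn hL.continuousOn
  refine ODE_solution_unique_of_mem_Ioo (v := fun t y => L t y) (s := fun _ => Set.univ)
    (K := C.toNNReal) (fun t ht => ?_) har (fun t _ => ⟨h₁ t, trivial⟩)
    (fun t _ => ⟨h₂ t, trivial⟩) ha hx
  refine ((L t).lipschitz.weaken ?_).lipschitzOnWith
  exact NNReal.le_toNNReal_of_coe_le (hC t (Set.Ioo_subset_Icc_self ht))

/-- Matrix multiplication as a continuous bilinear map for the entrywise norm. -/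
noncomputable def matrixMulCLM (m : ℕ) : Matrix (Fin m) (Fin m) ℂ →L[ℝ]
    Matrix (Fin m) (Fin m) ℂ →L[ℝ] Matrix (Fin m) (Fin m) ℂ :=
  (LinearMap.mul ℝ (Matrix (Fin m) (Fin m) ℂ)).toContinuousBilinearMap

/-- The product rule for matrix-valued functions. -/
theorem hasDerivAt_matrix_mul {m : ℕ} {M N : ℝ → Matrix (Fin m) (Fin m) ℂ}
    {M' N' : Matrix (Fin m) (Fin m) ℂ} {x : ℝ} (hM : HasDerivAt M M' x)
    (hN : HasDerivAt N N' x) :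
    HasDerivAt (fun t => M t * N t) (M x * N' + M' * N x) x :=
  (matrixMulCLM m).hasDerivAt_of_bilinear (fun _ => hM) (fun _ => hN)

/-- Gauge covariance of parallel transport: if `g` is a differentiable unitary gauge
transformation, `Ã = gᴴ A g + gᴴ g'`, `P' = -A P` with `P a = 1`, and `P̃' = -Ã P̃` with
`P̃ a = 1`, then `P̃ x = g(x)ᴴ P(x) g(a)` for all `x`; in particular the parallel transport
operators satisfy `Ω̃(b,a) = g(b)ᴴ Ω(b,a) g(a)`. -/
theorem gauge_covariance_parallel_transport {m : ℕ}
    (A g P Pt : ℝ → Matrix (Fin m) (Fin m) ℂ)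
    (hA : Continuous A)
    (hg : Differentiable ℝ g)
    (hgu : ∀ x : ℝ, (g x)ᴴ * g x = 1)
    (a : ℝ)
    (hP : ∀ x : ℝ, HasDerivAt P (-(A x) * P x) x)
    (hPa : P a = 1)
    (hPt : ∀ x : ℝ,
      HasDerivAt Pt (-((g x)ᴴ * A x * g x + (g x)ᴴ * deriv g x) * Pt x) x)
    (hPta : Pt a = 1) :
    (∀ x : ℝ, Pt x = (g x)ᴴ * P x * g a) ∧
      (∀ b : ℝ, Pt b * (Pt a)⁻¹ = (g b)ᴴ * (P b * (P a)⁻¹) * g a) := by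
  have hgu' : ∀ x, g x * (g x)ᴴ = 1 := fun x => mul_eq_one_comm.mp (hgu x)
  have key : ∀ x, g x * Pt x = P x * g a := by
    refine linear_ode_unique (L := fun t => matrixMulCLM m (-(A t)))
      ((matrixMulCLM m).continuous.comp hA.neg) (a := a) (fun t => ?_) (fun t => ?_) ?_
    · refine (hasDerivAt_matrix_mul (hg t).hasDerivAt (hPt t)).congr_deriv ?_
      change _ = -(A t) * (g t * Pt t)
      have h : g t * (-((g t)ᴴ * A t * g t + (g t)ᴴ * deriv g t) * Pt t) =
          -((g t * (g t)ᴴ) * (A t * g t * Pt t) + (g t * (g t)ᴴ) * (deriv g t * Pt t)) := by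
        noncomm_ring
      rw [h, hgu', one_mul, one_mul, neg_mul, mul_assoc, neg_add]
      exact neg_add_cancel_right _ _
    · refine (hasDerivAt_matrix_mul (hP t) (hasDerivAt_const t (g a))).congr_deriv ?_
      change _ = -(A t) * (P t * g a)
      noncomm_ring
    · rw [hPa, hPta, one_mul, mul_one]
  have main : ∀ x, Pt x = (g x)ᴴ * P x * g a := fun x => by
    rw [mul_assoc, ← key x, ← mul_assoc, hgu, one_mul]
  exact ⟨main, fun b => by simpa [hPa, hPta] using main b⟩
end

section
/- Let v : ℝ → Matrix (Fin n) (Fin m) ℂ be smooth with v(x)ᴴ v(x) = 1 for all x, and fix x ∈ ℝ. Then, as h → 0, the matrix v(x)ᴴ v(x+h) is invertible for all sufficiently small h and ( v(x)ᴴ v(x+h) )⁻¹ = 1 − h v(x)ᴴ v'(x) + h² ( (v(x)ᴴ v'(x))² − (1/2) v(x)ᴴ v''(x) ) + O(h³). -/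
open Matrix Filter Asymptotics

attribute [local instance] Matrix.normedAddCommGroup Matrix.normedSpace

/-- The product of matrices is compatible with big-O bounds in the entrywise sup norm. -/
theorem Matrix.isBigO_mul {α l m n : Type*} [Fintype l] [Fintype m] [Fintype n]
    {F : Filter α} {A : α → Matrix l m ℂ} {B : α → Matrix m n ℂ} {f g : α → ℝ}
    (hA : A =O[F] f) (hB : B =O[F] g) :
    (fun a => A a * B a) =O[F] fun a => f a * g a := by
  have hA' : ∀ i j, (fun a => A a i j) =O[F] f := fun i j =>
    isBigO_pi.1 (isBigO_pi.1 hA i) j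
  have hB' : ∀ i j, (fun a => B a i j) =O[F] g := fun i j =>
    isBigO_pi.1 (isBigO_pi.1 hB i) j
  refine isBigO_pi.2 fun i => isBigO_pi.2 fun j => ?_
  simp only [Matrix.mul_apply]
  exact IsBigO.fun_sum fun k _ => (hA' i k).mul (hB' k j)

/-- Second-order Taylor expansion with a cubic remainder. -/
theorem ContDiff.isBigO_sub_taylor_two {E : Type*} [NormedAddCommGroup E] [NormedSpace ℝ E]
    {f : ℝ → E} (hf : ContDiff ℝ 3 f) (x : ℝ) :
    (fun h : ℝ => f (x + h) - (f x + h • deriv f x + (h ^ 2 / 2) • deriv (deriv f) x))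
      =O[nhds 0] fun h : ℝ => h ^ 3 := by
  have hshift : Tendsto (fun h : ℝ => x + h) (nhds 0) (nhds x) := by
    have hcont : Continuous fun h : ℝ => x + h := by fun_prop
    simpa using hcont.tendsto 0
  have hlittle := ((taylor_isLittleO_univ (x₀ := x) (n := 3) hf).comp_tendsto hshift).isBigO
  have hcube : (fun h : ℝ => (h ^ 3 / 6) • iteratedDeriv 3 f x)
      =O[nhds 0] fun h : ℝ => h ^ 3 := by
    refine IsBigO.of_bound (‖iteratedDeriv 3 f x‖ / 6) (Eventually.of_forall fun h => ?_)
    rw [norm_smul, norm_div, Real.norm_ofNat]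
    exact le_of_eq (by ring)
  refine ((hlittle.congr_right fun h => ?_).add hcube).congr_left fun h => ?_
  · simp
  · have h2 : iteratedDeriv 2 f = deriv (deriv f) := by
      rw [iteratedDeriv_succ, iteratedDeriv_one]
    simp only [Function.comp_apply, taylor_within_apply, Finset.sum_range_succ,
      Finset.sum_range_zero, iteratedDerivWithin_univ, add_sub_cancel_left, iteratedDeriv_zero,
      iteratedDeriv_one, h2]
    norm_num [Nat.factorial]
    module

/-- Inversion of a second-order expansion at the identity matrix. -/
theorem Matrix.isBigO_inv_sub {m : Type*} [Fintype m] [DecidableEq m]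
    {A : ℝ → Matrix m m ℂ} {B C : Matrix m m ℂ}
    (hcont : ContinuousAt A 0) (hzero : A 0 = 1)
    (hA : (fun h : ℝ => A h - (1 + h • B + h ^ 2 • C)) =O[nhds 0] fun h : ℝ => h ^ 3) :
    (∀ᶠ h : ℝ in nhds 0, IsUnit (A h)) ∧
    (fun h : ℝ => (A h)⁻¹ - (1 - h • B + h ^ 2 • (B ^ 2 - C)))
      =O[nhds 0] fun h : ℝ => h ^ 3 := by
  have hdet : ContinuousAt (fun h => (A h).det) 0 :=
    ContinuousAt.comp (g := Matrix.det) (Continuous.matrix_det continuous_id).continuousAt hcont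
  have hunit : ∀ᶠ h : ℝ in nhds 0, IsUnit (A h) := by
    have : ∀ᶠ h : ℝ in nhds 0, (A h).det ≠ 0 := hdet.eventually_ne (by simp [hzero])
    filter_upwards [this] with h hh
    exact (Matrix.isUnit_iff_isUnit_det _).2 hh.isUnit
  refine ⟨hunit, ?_⟩
  have hinv : ContinuousAt (fun h => (A h)⁻¹) 0 := by
    simp only [Matrix.inv_def, Ring.inverse_eq_inv]
    exact (hdet.inv₀ (by simp [hzero])).smul
      (ContinuousAt.comp (g := Matrix.adjugate)
        (Continuous.matrix_adjugate continuous_id).continuousAt hcont)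
  have hinvO : (fun h => (A h)⁻¹) =O[nhds 0] fun _ : ℝ => (1 : ℝ) := hinv.tendsto.isBigO_one ℝ
  have hPO : (fun h : ℝ => 1 - h • B + h ^ 2 • (B ^ 2 - C)) =O[nhds 0] fun _ : ℝ => (1 : ℝ) :=
    (Continuous.tendsto (by fun_prop) 0).isBigO_one ℝ
  have hQO : (fun h : ℝ => B ^ 3 - B * C - C * B + h • (C * (B ^ 2 - C)))
      =O[nhds 0] fun _ : ℝ => (1 : ℝ) :=
    (Continuous.tendsto (by fun_prop) 0).isBigO_one ℝ
  have hcube := (isBigO_refl (fun h : ℝ => h ^ 3) (nhds 0)).smul hQO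
  have hmain := Matrix.isBigO_mul hinvO (((Matrix.isBigO_mul hA hPO).add hcube).neg_left)
  refine (hmain.congr' ?_ (Eventually.of_forall fun h => by simp))
  filter_upwards [hunit] with h hh
  have hinvmul : (A h)⁻¹ * A h = 1 :=
    Matrix.nonsing_inv_mul _ ((Matrix.isUnit_iff_isUnit_det _).1 hh)
  set P := 1 - h • B + h ^ 2 • (B ^ 2 - C) with hP
  have hprod : -((A h - (1 + h • B + h ^ 2 • C)) * P +
      h ^ 3 • (B ^ 3 - B * C - C * B + h • (C * (B ^ 2 - C)))) = 1 - A h * P := by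
    have : (1 + h • B + h ^ 2 • C) * P =
        1 + h ^ 3 • (B ^ 3 - B * C - C * B + h • (C * (B ^ 2 - C))) := by
      rw [hP]
      simp only [mul_add, add_mul, mul_sub, smul_mul_assoc, mul_smul_comm, one_mul,
        mul_one, pow_succ, pow_zero, mul_assoc]
      module
    rw [sub_mul, this]
    abel
  rw [hprod, mul_sub, mul_one, ← mul_assoc, hinvmul, one_mul]

/-- Taylor expansion of `(v(x)ᴴ v(x+h))⁻¹`: if `v` is smooth with `vᴴ v = 1`, then
`v(x)ᴴ v(x+h)` is invertible for all sufficiently small `h` and, as `h → 0`,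
`(v(x)ᴴ v(x+h))⁻¹ = 1 - h vᴴ v' + h² ((vᴴ v')² - ½ vᴴ v'') + O(h³)`. -/
theorem taylor_expansion_pi2 {n m : ℕ}
    (v : ℝ → Matrix (Fin n) (Fin m) ℂ)
    (hv : ContDiff ℝ (⊤ : ℕ∞) v)
    (horth : ∀ x : ℝ, (v x)ᴴ * v x = 1)
    (x : ℝ) :
    (∀ᶠ h : ℝ in nhds 0, IsUnit ((v x)ᴴ * v (x + h))) ∧
    (fun h : ℝ => ((v x)ᴴ * v (x + h))⁻¹ -
        (1 - h • ((v x)ᴴ * deriv v x)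
          + (h ^ 2) • (((v x)ᴴ * deriv v x) ^ 2
              - (1 / 2 : ℝ) • ((v x)ᴴ * deriv (deriv v) x))))
      =O[nhds 0] fun h : ℝ => h ^ 3 := by
  have hcont : Continuous v := hv.continuous
  have hA : (fun h : ℝ => (v x)ᴴ * v (x + h) -
      (1 + h • ((v x)ᴴ * deriv v x) + h ^ 2 • ((1 / 2 : ℝ) • ((v x)ᴴ * deriv (deriv v) x))))
      =O[nhds 0] fun h : ℝ => h ^ 3 := by
    have htaylor := (contDiff_infty.1 hv 3).isBigO_sub_taylor_two x
    have hconst : (fun _ : ℝ => (v x)ᴴ) =O[nhds 0] fun _ : ℝ => (1 : ℝ) :=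
      tendsto_const_nhds.isBigO_one ℝ
    refine (Matrix.isBigO_mul hconst htaylor).congr (fun h => ?_) fun h => one_mul _
    rw [Matrix.mul_sub, Matrix.mul_add, Matrix.mul_add, horth, Matrix.mul_smul,
      Matrix.mul_smul, smul_smul, mul_one_div]
    rfl
  exact Matrix.isBigO_inv_sub (by fun_prop) (by simp [horth]) hA
end

section
/- Let v : ℝ → Matrix (Fin n) (Fin m) ℂ be smooth with v(x)ᴴ v(x) = 1 for all x, let A(x) = v(x)ᴴ v'(x), let P solve P'(x) = −A(x) P(x), P(x₀) = 1, and let Ω(b,a) = P(b) P(a)⁻¹ be the parallel transport operator. Then for every fixed x ∈ ℝ, as h → 0, Ω(x+h, x) − v(x+h)ᴴ v(x) = O(h²). -/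
open Matrix Filter Asymptotics

attribute [local instance] Matrix.normedAddCommGroup Matrix.normedSpace

/-- A function vanishing to first order at `x`, whose derivative is differentiable at `x`,
is `O((y - x)²)` as `y → x`. -/
theorem isBigO_sq_of_hasDerivAt {E : Type*} [NormedAddCommGroup E] [NormedSpace ℝ E]
    {f f' : ℝ → E} {x : ℝ} (hf : ∀ y, HasDerivAt f (f' y) y) (hf' : DifferentiableAt ℝ f' x)
    (h₀ : f x = 0) (h₁ : f' x = 0) :
    f =O[nhds x] fun y => (y - x) ^ 2 := by
  have hO : f' =O[nhds x] fun y => y - x := by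
    simpa [h₁] using hf'.hasFDerivAt.isBigO_sub
  obtain ⟨C, hC, hb⟩ := hO.exists_pos
  obtain ⟨ε, hε, hball⟩ := Metric.eventually_nhds_iff_ball.1 hb.bound
  refine IsBigO.of_bound C (Metric.eventually_nhds_iff_ball.2 ⟨ε, hε, fun y hy => ?_⟩)
  have hmv := (convex_closedBall x (dist y x)).norm_image_sub_le_of_norm_hasDerivWithin_le
    (f := f) (f' := f') (C := C * dist y x) (x := x) (y := y)
    (fun z _ => (hf z).hasDerivWithinAt)
    (fun z hz => (hball z ((Metric.mem_closedBall.1 hz).trans_lt hy)).trans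
      (mul_le_mul_of_nonneg_left (by simpa [Real.dist_eq] using hz) hC.le))
    (by simp) (by simp)
  rw [h₀, sub_zero, Real.dist_eq] at hmv
  rw [norm_pow, Real.norm_eq_abs, sq, ← mul_assoc]
  exact hmv

section MatrixDerivatives

variable {l k p : Type*} [Fintype l] [Fintype k] [Fintype p]

theorem HasDerivAt.matrix_mul {M : ℝ → Matrix l k ℂ} {N : ℝ → Matrix k p ℂ}
    {M' : Matrix l k ℂ} {N' : Matrix k p ℂ} {x : ℝ}
    (hM : HasDerivAt M M' x) (hN : HasDerivAt N N' x) :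
    HasDerivAt (fun y => M y * N y) (M' * N x + M x * N') x := by
  have h := (mulLinearMap (l := l) (m := k) (n := p) (A := ℂ)
    ℝ).toContinuousBilinearMap.hasDerivAt_of_bilinear (fun _ => hM) (fun _ => hN)
  rw [add_comm]
  exact h

theorem HasDerivAt.matrix_conjTranspose {M : ℝ → Matrix l k ℂ} {M' : Matrix l k ℂ} {x : ℝ}
    (hM : HasDerivAt M M' x) : HasDerivAt (fun y => (M y)ᴴ) M'ᴴ x :=
  hasDerivAt_pi.2 fun i => hasDerivAt_pi.2 fun j =>
    (hasDerivAt_pi.1 (hasDerivAt_pi.1 hM j) i).star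

end MatrixDerivatives

/-- If `vᴴ v` is constant, then `vᴴ v'` is anti-hermitian. -/
theorem conjTranspose_deriv_mul_eq_neg {n m : ℕ} {v : ℝ → Matrix (Fin n) (Fin m) ℂ}
    (hv : Differentiable ℝ v) (horth : ∀ x : ℝ, (v x)ᴴ * v x = 1) (x : ℝ) :
    (deriv v x)ᴴ * v x = -((v x)ᴴ * deriv v x) := by
  have h := (hv x).hasDerivAt.matrix_conjTranspose.matrix_mul (hv x).hasDerivAt
  simp only [horth] at h
  exact eq_neg_of_add_eq_zero_left (h.unique (hasDerivAt_const x _))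

/-- Solutions of `P' = -A P`, `P x₀ = 1` with `A` anti-hermitian are unitary. -/
theorem conjTranspose_mul_self_eq_one {m : ℕ} {P A : ℝ → Matrix (Fin m) (Fin m) ℂ} {x₀ : ℝ}
    (hA : ∀ x, (A x)ᴴ = -A x) (hP : ∀ x, HasDerivAt P (-A x * P x) x) (hP₀ : P x₀ = 1) (x : ℝ) :
    (P x)ᴴ * P x = 1 := by
  have h (y : ℝ) : HasDerivAt (fun y => (P y)ᴴ * P y) 0 y := by
    convert (hP y).matrix_conjTranspose.matrix_mul (hP y) using 1
    simp [hA, Matrix.mul_assoc]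
  have hc := is_const_of_deriv_eq_zero (fun y => (h y).differentiableAt) (fun y => (h y).deriv)
    x x₀
  simpa [hP₀] using hc

/-- The order-1 approximation to parallel transport of the induced connection: if `v` is smooth
with `vᴴ v = 1`, `A = vᴴ v'`, `P' = -A P`, `P x₀ = 1` and `Ω(b,a) = P(b) P(a)⁻¹`, then
`Ω(x+h, x) - v(x+h)ᴴ v(x) = O(h²)` as `h → 0`. -/
theorem order_one_approximation {n m : ℕ}
    (v : ℝ → Matrix (Fin n) (Fin m) ℂ)
    (hv : ContDiff ℝ (⊤ : ℕ∞) v)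
    (horth : ∀ x : ℝ, (v x)ᴴ * v x = 1)
    (P : ℝ → Matrix (Fin m) (Fin m) ℂ)
    (x₀ : ℝ)
    (hP : ∀ x : ℝ, HasDerivAt P (-((v x)ᴴ * deriv v x) * P x) x)
    (hP₀ : P x₀ = 1)
    (Ω : ℝ → ℝ → Matrix (Fin m) (Fin m) ℂ)
    (hΩ : ∀ b a : ℝ, Ω b a = P b * (P a)⁻¹)
    (x : ℝ) :
    (fun h : ℝ => Ω (x + h) x - (v (x + h))ᴴ * v x) =O[nhds 0] fun h : ℝ => h ^ 2 := by
  have hdv : Differentiable ℝ v := hv.differentiable (by simp)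
  have hd2 : Differentiable ℝ (deriv v) :=
    (contDiff_infty_iff_deriv.1 hv).2.differentiable (by simp)
  have hanti := conjTranspose_deriv_mul_eq_neg hdv horth
  have hunit := conjTranspose_mul_self_eq_one (A := fun y => (v y)ᴴ * deriv v y)
    (fun y => by simpa using hanti y) hP hP₀ x
  have hinv : P x * (P x)⁻¹ = 1 :=
    Matrix.mul_nonsing_inv _ (Matrix.isUnit_det_of_left_inverse hunit)
  have hmul (M : ℝ → Matrix (Fin m) (Fin m) ℂ) (M' : Matrix (Fin m) (Fin m) ℂ) (y : ℝ)
      (hM : HasDerivAt M M' y) : HasDerivAt (fun z => M z * (P x)⁻¹) (M' * (P x)⁻¹) y := by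
    simpa using hM.matrix_mul (hasDerivAt_const y (P x)⁻¹)
  have hmulv (M : ℝ → Matrix (Fin m) (Fin n) ℂ) (M' : Matrix (Fin m) (Fin n) ℂ) (y : ℝ)
      (hM : HasDerivAt M M' y) : HasDerivAt (fun z => M z * v x) (M' * v x) y := by
    simpa using hM.matrix_mul (hasDerivAt_const y (v x))
  have hO := isBigO_sq_of_hasDerivAt (x := x)
    (fun y => (hmul _ _ y (hP y)).sub (hmulv _ _ y (hdv y).hasDerivAt.matrix_conjTranspose))
    ((hmul _ _ x (((hdv x).hasDerivAt.matrix_conjTranspose.matrix_mul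
      (hd2 x).hasDerivAt).neg.matrix_mul (hP x))).sub
      (hmulv _ _ x (hd2 x).hasDerivAt.matrix_conjTranspose)).differentiableAt
    (by simp [hinv, horth])
    (by
      simp only [Matrix.mul_assoc, hinv, Matrix.mul_one]
      exact sub_eq_zero.2 (hanti x).symm)
  have ht : Tendsto (fun h : ℝ => x + h) (nhds 0) (nhds x) := by
    simpa using (continuous_const_add x).tendsto 0
  simpa [hΩ, Function.comp_def] using hO.comp_tendsto ht
end

section
/- Let v : ℝ → Matrix (Fin n) (Fin m) ℂ be smooth with v(x)ᴴ v(x) = 1 for all x, let A(x) = v(x)ᴴ v'(x), let P solve P'(x) = −A(x) P(x), P(x₀) = 1, and let Ω(b,a) = P(b) P(a)⁻¹. Define Ω²(b,a) = (1/2) ( v(b)ᴴ v(a) + ( v(a)ᴴ v(b) )⁻¹ ). Then for every fixed x ∈ ℝ, as h → 0, Ω(x+h, x) − Ω²(x+h, x) = O(h³). -/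
open Matrix Filter Asymptotics

attribute [local instance] Matrix.normedAddCommGroup Matrix.normedSpace

/-- The order-2 approximation to parallel transport:
`Ω²(b,a) = ½ (v(b)ᴴ v(a) + (v(a)ᴴ v(b))⁻¹)`. -/
noncomputable def Omega2 {n m : ℕ} (v : ℝ → Matrix (Fin n) (Fin m) ℂ) (b a : ℝ) :
    Matrix (Fin m) (Fin m) ℂ :=
  (1 / 2 : ℂ) • ((v b)ᴴ * v a + ((v a)ᴴ * v b)⁻¹)

open Topology

/-- Differentiability of a matrix-valued curve is entrywise differentiability. -/
theorem Matrix.hasDerivAt_iff_entries {k l : ℕ} {F : ℝ → Matrix (Fin k) (Fin l) ℂ}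
    {F' : Matrix (Fin k) (Fin l) ℂ} {t : ℝ} :
    HasDerivAt F F' t ↔ ∀ i j, HasDerivAt (fun s => F s i j) (F' i j) t := by
  refine (hasDerivAt_pi (φ := F) (φ' := F')).trans (forall_congr' fun i => ?_)
  exact hasDerivAt_pi (φ := fun s => F s i) (φ' := F' i)

/-- The Leibniz rule for products of matrix-valued curves. -/
theorem Matrix.hasDerivAt_mul {k l p : ℕ} {F : ℝ → Matrix (Fin k) (Fin l) ℂ}
    {G : ℝ → Matrix (Fin l) (Fin p) ℂ} {F' : Matrix (Fin k) (Fin l) ℂ}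
    {G' : Matrix (Fin l) (Fin p) ℂ} {t : ℝ} (hF : HasDerivAt F F' t) (hG : HasDerivAt G G' t) :
    HasDerivAt (fun s => F s * G s) (F' * G t + F t * G') t := by
  rw [Matrix.hasDerivAt_iff_entries] at *
  intro i j
  simp only [Matrix.mul_apply, Matrix.add_apply, ← Finset.sum_add_distrib]
  exact HasDerivAt.fun_sum fun q _ => (hF i q).fun_mul (hG q j)

/-- The conjugate transpose commutes with differentiation along a real curve. -/
theorem Matrix.hasDerivAt_conjTranspose {k l : ℕ} {F : ℝ → Matrix (Fin k) (Fin l) ℂ}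
    {F' : Matrix (Fin k) (Fin l) ℂ} {t : ℝ} (hF : HasDerivAt F F' t) :
    HasDerivAt (fun s => (F s)ᴴ) F'ᴴ t := by
  rw [Matrix.hasDerivAt_iff_entries] at *
  exact fun i j => (hF j i).star

/-- A product of matrix-valued functions, the first bounded, is controlled by the second. -/
theorem Matrix.isBigO_mul_of_isBigO_one {α : Type*} {f : Filter α} {k l p : ℕ}
    {F : α → Matrix (Fin k) (Fin l) ℂ} {G : α → Matrix (Fin l) (Fin p) ℂ} {g : α → ℝ}
    (hF : F =O[f] fun _ => (1 : ℝ)) (hG : G =O[f] g) :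
    (fun s => F s * G s) =O[f] g := by
  have entry {a b : ℕ} (H : α → Matrix (Fin a) (Fin b) ℂ) (i : Fin a) (j : Fin b) :
      (fun s => H s i j) =O[f] H :=
    IsBigO.of_bound 1 <| Eventually.of_forall fun s => by
      simpa using Matrix.norm_entry_le_entrywise_sup_norm (H s)
  refine isBigO_pi.2 fun i => isBigO_pi.2 fun j => ?_
  simp only [Matrix.mul_apply]
  refine IsBigO.fun_sum fun q _ => ?_
  simpa only [one_mul] using ((entry F i q).trans hF).mul ((entry G q j).trans hG)

/-- If `f x = 0` and `f' = O((t - x)^k)` at `x`, then `f = O((t - x)^(k+1))`. -/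
theorem isBigO_pow_succ_of_hasDerivAt {E : Type*} [NormedAddCommGroup E] [NormedSpace ℝ E]
    {f f' : ℝ → E} {x : ℝ} {k : ℕ} (hf : ∀ t, HasDerivAt f (f' t) t) (h0 : f x = 0)
    (h : f' =O[𝓝 x] fun t => (t - x) ^ k) : f =O[𝓝 x] fun t => (t - x) ^ (k + 1) := by
  obtain ⟨C, hC⟩ := h.bound
  obtain ⟨ε, hε, hball⟩ := Metric.eventually_nhds_iff.1 hC
  refine IsBigO.of_bound C ?_
  filter_upwards [Metric.ball_mem_nhds x hε] with t ht
  have hxt : ∀ s ∈ Set.uIcc x t, |s - x| ≤ |t - x| := fun s hs => Set.abs_sub_left_of_mem_uIcc hs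
  have hb : ∀ s ∈ Set.uIcc x t, ‖f' s‖ ≤ C * |t - x| ^ k := by
    intro s hs
    have hs' := hxt s hs
    have hsε : dist s x < ε := by
      rw [Real.dist_eq]; exact hs'.trans_lt (by simpa [Real.dist_eq] using ht)
    have hbs := hball hsε
    rw [norm_pow, Real.norm_eq_abs] at hbs
    rcases le_or_gt 0 C with hC0 | hC0
    · exact hbs.trans (by gcongr)
    · have hz : (|s - x|) ^ k = 0 := by
        have h1 : 0 ≤ C * |s - x| ^ k := (norm_nonneg _).trans hbs
        have h2 : 0 ≤ |s - x| ^ k := by positivity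
        nlinarith
      have htb := hball ht
      rw [norm_pow, Real.norm_eq_abs] at htb
      have h1 : 0 ≤ C * |t - x| ^ k := (norm_nonneg _).trans htb
      rw [hz, mul_zero] at hbs
      exact hbs.trans h1
  have := (convex_uIcc x t).norm_image_sub_le_of_norm_hasDerivWithin_le
    (fun s _ => (hf s).hasDerivWithinAt) hb Set.left_mem_uIcc Set.right_mem_uIcc
  rw [h0, sub_zero, Real.norm_eq_abs] at this
  rwa [norm_pow, Real.norm_eq_abs, pow_succ, ← mul_assoc]

/-- A twice differentiable curve whose second derivative is differentiable at `x`, and which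
vanishes to second order at `x`, is `O((t - x)^3)`. -/
theorem isBigO_cube_of_hasDerivAt {E : Type*} [NormedAddCommGroup E] [NormedSpace ℝ E]
    {f f₁ f₂ : ℝ → E} {x : ℝ} (hf : ∀ t, HasDerivAt f (f₁ t) t)
    (hf₁ : ∀ t, HasDerivAt f₁ (f₂ t) t) (hf₂ : DifferentiableAt ℝ f₂ x)
    (h0 : f x = 0) (h1 : f₁ x = 0) (h2 : f₂ x = 0) :
    f =O[𝓝 x] fun t => (t - x) ^ 3 := by
  have hO : f₂ =O[𝓝 x] fun t => (t - x) ^ 1 := by simpa [h2] using hf₂.isBigO_sub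
  exact isBigO_pow_succ_of_hasDerivAt hf h0 (isBigO_pow_succ_of_hasDerivAt hf₁ h1 hO)

/-- The second derivative of a product of twice differentiable matrix-valued curves. -/
theorem Matrix.hasDerivAt_deriv_mul {k l p : ℕ} {F F₁ F₂ : ℝ → Matrix (Fin k) (Fin l) ℂ}
    {G G₁ G₂ : ℝ → Matrix (Fin l) (Fin p) ℂ} {t : ℝ}
    (hF : HasDerivAt F (F₁ t) t) (hF₁ : HasDerivAt F₁ (F₂ t) t)
    (hG : HasDerivAt G (G₁ t) t) (hG₁ : HasDerivAt G₁ (G₂ t) t) :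
    HasDerivAt (fun s => F₁ s * G s + F s * G₁ s)
      (F₂ t * G t + F₁ t * G₁ t + (F₁ t * G₁ t + F t * G₂ t)) t :=
  (Matrix.hasDerivAt_mul hF₁ hG).add (Matrix.hasDerivAt_mul hF hG₁)

/-- If a product of matrix-valued curves agrees with a constant to second order at `x`, then the
difference is `O((t - x)^3)`. -/
theorem Matrix.isBigO_cube_mul_sub_const {k l p : ℕ} {F F₁ F₂ : ℝ → Matrix (Fin k) (Fin l) ℂ}
    {G G₁ G₂ : ℝ → Matrix (Fin l) (Fin p) ℂ} {x : ℝ} {K : Matrix (Fin k) (Fin p) ℂ}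
    (hF : ∀ t, HasDerivAt F (F₁ t) t) (hF₁ : ∀ t, HasDerivAt F₁ (F₂ t) t)
    (hF₂ : DifferentiableAt ℝ F₂ x) (hG : ∀ t, HasDerivAt G (G₁ t) t)
    (hG₁ : ∀ t, HasDerivAt G₁ (G₂ t) t) (hG₂ : DifferentiableAt ℝ G₂ x)
    (h0 : F x * G x = K) (h1 : F₁ x * G x + F x * G₁ x = 0)
    (h2 : F₂ x * G x + F₁ x * G₁ x + (F₁ x * G₁ x + F x * G₂ x) = 0) :
    (fun t => F t * G t - K) =O[𝓝 x] fun t => (t - x) ^ 3 := by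
  have hd := (Matrix.hasDerivAt_mul (hF₁ x) (hG₁ x))
  have hd₂ := ((Matrix.hasDerivAt_mul hF₂.hasDerivAt (hG x)).fun_add hd).fun_add
    (hd.fun_add (Matrix.hasDerivAt_mul (hF x) hG₂.hasDerivAt))
  exact isBigO_cube_of_hasDerivAt (fun t => (Matrix.hasDerivAt_mul (hF t) (hG t)).sub_const K)
    (fun t => Matrix.hasDerivAt_deriv_mul (hF t) (hF₁ t) (hG t) (hG₁ t))
    hd₂.differentiableAt (sub_eq_zero.2 h0) h1 h2

/-- A solution of `P' = -A P` with `A` anti-Hermitian and `P x₀ = 1` is unitary. -/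
theorem Matrix.conjTranspose_mul_self_eq_one_of_hasDerivAt {m : ℕ}
    {A P : ℝ → Matrix (Fin m) (Fin m) ℂ} {x₀ : ℝ} (hA : ∀ t, (A t)ᴴ = -A t)
    (hP : ∀ t, HasDerivAt P (-A t * P t) t) (hP₀ : P x₀ = 1) (t : ℝ) :
    (P t)ᴴ * P t = 1 := by
  have hd : ∀ s, HasDerivAt (fun s => (P s)ᴴ * P s) 0 s := fun s => by
    convert Matrix.hasDerivAt_mul (Matrix.hasDerivAt_conjTranspose (hP s)) (hP s) using 1
    simp [Matrix.conjTranspose_mul, hA, Matrix.mul_assoc]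
  have := is_const_of_deriv_eq_zero (fun s => (hd s).differentiableAt) (fun s => (hd s).deriv) t x₀
  simpa [hP₀] using this

/-- The order-2 approximation to parallel transport of the induced connection: if `v` is smooth
with `vᴴ v = 1`, `A = vᴴ v'`, `P' = -A P`, `P x₀ = 1` and `Ω(b,a) = P(b) P(a)⁻¹`, then
`Ω(x+h, x) - Ω²(x+h, x) = O(h³)` as `h → 0`. -/
theorem order_two_approximation {n m : ℕ}
    (v : ℝ → Matrix (Fin n) (Fin m) ℂ)
    (hv : ContDiff ℝ (⊤ : ℕ∞) v)
    (horth : ∀ x : ℝ, (v x)ᴴ * v x = 1)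
    (P : ℝ → Matrix (Fin m) (Fin m) ℂ)
    (x₀ : ℝ)
    (hP : ∀ x : ℝ, HasDerivAt P (-((v x)ᴴ * deriv v x) * P x) x)
    (hP₀ : P x₀ = 1)
    (Ω : ℝ → ℝ → Matrix (Fin m) (Fin m) ℂ)
    (hΩ : ∀ b a : ℝ, Ω b a = P b * (P a)⁻¹)
    (x : ℝ) :
    (fun h : ℝ => Ω (x + h) x - Omega2 v (x + h) x) =O[nhds 0] fun h : ℝ => h ^ 3 := by
  have hv₁ : ContDiff ℝ (⊤ : ℕ∞) (deriv v) := (contDiff_infty_iff_deriv.1 hv).2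
  have hv₂ : ContDiff ℝ (⊤ : ℕ∞) (deriv (deriv v)) := (contDiff_infty_iff_deriv.1 hv₁).2
  have d0 : ∀ t, HasDerivAt v (deriv v t) t := fun t =>
    ((contDiff_infty_iff_deriv.1 hv).1 t).hasDerivAt
  have d1 : ∀ t, HasDerivAt (deriv v) (deriv (deriv v) t) t := fun t =>
    ((contDiff_infty_iff_deriv.1 hv₁).1 t).hasDerivAt
  have d2 : ∀ t, HasDerivAt (deriv (deriv v)) (deriv (deriv (deriv v)) t) t := fun t =>
    ((contDiff_infty_iff_deriv.1 hv₂).1 t).hasDerivAt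
  generalize deriv (deriv (deriv v)) = v₃ at d2
  generalize deriv (deriv v) = v₂ at d1 d2
  generalize deriv v = v₁ at d0 d1 hP
  clear hv hv₁ hv₂
  have o1 : ∀ t, (v₁ t)ᴴ * v t + (v t)ᴴ * v₁ t = 0 := fun t => by
    refine (Matrix.hasDerivAt_mul (Matrix.hasDerivAt_conjTranspose (d0 t)) (d0 t)).unique ?_
    simpa only [horth] using hasDerivAt_const t (1 : Matrix (Fin m) (Fin m) ℂ)
  have o2 : ∀ t, (v₂ t)ᴴ * v t + (v₁ t)ᴴ * v₁ t + ((v₁ t)ᴴ * v₁ t + (v t)ᴴ * v₂ t) = 0 :=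
    fun t => by
    refine (Matrix.hasDerivAt_deriv_mul (F := fun t => (v t)ᴴ) (F₁ := fun t => (v₁ t)ᴴ)
      (F₂ := fun t => (v₂ t)ᴴ)
      (Matrix.hasDerivAt_conjTranspose (d0 t)) (Matrix.hasDerivAt_conjTranspose (d1 t))
      (d0 t) (d1 t)).unique ?_
    simpa only [o1] using hasDerivAt_const t (0 : Matrix (Fin m) (Fin m) ℂ)
  obtain ⟨A, hA⟩ : ∃ A : ℝ → Matrix (Fin m) (Fin m) ℂ, ∀ t, A t = (v t)ᴴ * v₁ t :=
    ⟨_, fun _ => rfl⟩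
  obtain ⟨A₁, hA₁⟩ : ∃ A₁ : ℝ → Matrix (Fin m) (Fin m) ℂ,
      ∀ t, A₁ t = (v₁ t)ᴴ * v₁ t + (v t)ᴴ * v₂ t := ⟨_, fun _ => rfl⟩
  have dA : ∀ t, HasDerivAt A (A₁ t) t := fun t => by
    rw [funext hA, hA₁]
    exact Matrix.hasDerivAt_mul (Matrix.hasDerivAt_conjTranspose (d0 t)) (d1 t)
  have dA₁ : ∀ t, DifferentiableAt ℝ A₁ t := fun t => by
    rw [funext hA₁]
    exact ((Matrix.hasDerivAt_mul (Matrix.hasDerivAt_conjTranspose (d1 t)) (d1 t)).add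
      (Matrix.hasDerivAt_mul (Matrix.hasDerivAt_conjTranspose (d0 t)) (d2 t))).differentiableAt
  have hAh : ∀ t, (A t)ᴴ = -A t := fun t => by
    rw [hA, Matrix.conjTranspose_mul, Matrix.conjTranspose_conjTranspose]
    exact eq_neg_of_add_eq_zero_left (o1 t)
  simp only [← hA] at hP
  have hPx := Matrix.conjTranspose_mul_self_eq_one_of_hasDerivAt hAh hP hP₀ x
  obtain ⟨Q, hQ⟩ : ∃ Q : ℝ → Matrix (Fin m) (Fin m) ℂ, ∀ t, Q t = P t * (P x)⁻¹ :=
    ⟨_, fun _ => rfl⟩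
  have hQx : Q x = 1 := by
    rw [hQ, Matrix.inv_eq_left_inv hPx]
    exact mul_eq_one_comm.1 hPx
  have dQ : ∀ t, HasDerivAt Q (-A t * Q t) t := fun t => by
    rw [funext hQ]
    simpa [Matrix.mul_assoc] using Matrix.hasDerivAt_mul (hP t) (hasDerivAt_const t (P x)⁻¹)
  obtain ⟨Q₂, hQ₂⟩ : ∃ Q₂ : ℝ → Matrix (Fin m) (Fin m) ℂ,
      ∀ t, Q₂ t = -A₁ t * Q t + -A t * (-A t * Q t) := ⟨_, fun _ => rfl⟩
  have dQ₁ : ∀ t, HasDerivAt (fun s => -A s * Q s) (Q₂ t) t := fun t => by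
    rw [hQ₂]
    exact Matrix.hasDerivAt_mul (dA t).fun_neg (dQ t)
  have dQ₂ : DifferentiableAt ℝ Q₂ x := by
    rw [funext hQ₂]
    exact ((Matrix.hasDerivAt_mul (dA₁ x).hasDerivAt.fun_neg (dQ x)).add
      (Matrix.hasDerivAt_mul (dA x).fun_neg (dQ₁ x))).differentiableAt
  have c {f : ℝ → Matrix (Fin n) (Fin m) ℂ} {f' : Matrix (Fin n) (Fin m) ℂ} {t : ℝ}
      (hf : HasDerivAt f f' t) : HasDerivAt (fun s => (v x)ᴴ * f s) ((v x)ᴴ * f') t := by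
    simpa using Matrix.hasDerivAt_mul (hasDerivAt_const t (v x)ᴴ) hf
  have c' {f : ℝ → Matrix (Fin n) (Fin m) ℂ} {f' : Matrix (Fin n) (Fin m) ℂ} {t : ℝ}
      (hf : HasDerivAt f f' t) : HasDerivAt (fun s => (f s)ᴴ * v x) (f'ᴴ * v x) t := by
    simpa using Matrix.hasDerivAt_mul (Matrix.hasDerivAt_conjTranspose hf)
      (hasDerivAt_const t (v x))
  have e0 t := ((dQ t).fun_add (dQ t)).fun_sub (c' (d0 t))
  have e1 t := ((dQ₁ t).fun_add (dQ₁ t)).fun_sub (c' (d1 t))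
  have e2 := (dQ₂.hasDerivAt.fun_add dQ₂.hasDerivAt).fun_sub (c' (d2 x))
  have key : (fun t => (v x)ᴴ * v t * (Q t + Q t - (v t)ᴴ * v x) - 1)
      =O[𝓝 x] fun t => (t - x) ^ 3 := by
    refine Matrix.isBigO_cube_mul_sub_const (fun t => c (d0 t)) (fun t => c (d1 t))
      (c (d2 x)).differentiableAt e0 e1 e2.differentiableAt ?_ ?_ ?_
    · simp [horth, hQx]
    · have h1 := o1 x
      rw [← hA] at h1
      simp only [horth, hQx, ← hA, eq_neg_of_add_eq_zero_left h1]
      noncomm_ring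
    · have h1 := o1 x
      have h2 := o2 x
      rw [← hA] at h1
      simp only [horth, hQx, hQ₂, hA₁, ← hA, eq_neg_of_add_eq_zero_left h1]
      rw [← neg_eq_zero, ← h2]
      noncomm_ring
  have hM : Continuous fun t => (v x)ᴴ * v t :=
    continuous_iff_continuousAt.2 fun t => (c (d0 t)).continuousAt
  have hdet : ∀ᶠ t in 𝓝 x, IsUnit ((v x)ᴴ * v t).det := by
    have h := hM.matrix_det.continuousAt (x := x)
    filter_upwards [h.eventually_ne (y := 0) (by simp [horth])] with t ht using ht.isUnit
  have hinv : (fun t => ((v x)ᴴ * v t)⁻¹) =O[𝓝 x] fun _ => (1 : ℝ) := by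
    refine Tendsto.isBigO_one ℝ (c := ((v x)ᴴ * v x)⁻¹) ?_
    simp only [Matrix.inv_def, Ring.inverse_eq_inv']
    exact ((hM.matrix_det.continuousAt (x := x)).inv₀ (by simp [horth])).smul
      (hM.matrix_adjugate.continuousAt (x := x))
  have hmain : (fun t => Ω t x - Omega2 v t x) =O[𝓝 x] fun t => (t - x) ^ 3 := by
    refine IsBigO.congr' ((Matrix.isBigO_mul_of_isBigO_one hinv key).const_smul_left (1 / 2 : ℂ))
      ?_ EventuallyEq.rfl
    filter_upwards [hdet] with t ht
    simp only [Pi.smul_apply]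
    rw [hΩ, ← hQ, Omega2, Matrix.mul_sub, Matrix.nonsing_inv_mul_cancel_left _ _ ht, Matrix.mul_one]
    module
  have hshift : Tendsto (fun h : ℝ => x + h) (𝓝 0) (𝓝 x) := by
    simpa using (continuous_const.add continuous_id).tendsto (f := fun h : ℝ => x + h) 0
  simpa [Function.comp_def] using hmain.comp_tendsto hshift
end

section
/- For t ∈ ℝ let Γ(t) be the 2×4 complex matrix Γ(t) = [[cos t, 0, sin t, cos t], [0, cos t, −cos t, sin t]]. Suppose v : ℝ → Matrix (Fin 4) (Fin 2) ℂ is smooth and satisfies Γ(t) v(t) = 0 and v(t)ᴴ v(t) = 1 for all t ∈ [−π/2, π/2], and v(−π/2) = v(π/2) = the 4×2 matrix with rows (1,0), (0,1), (0,0), (0,0). Let Ω : ℝ → Matrix (Fin 2) (Fin 2) ℂ satisfy Ω'(t) = −(v(t)ᴴ v'(t)) Ω(t) on [−π/2, π/2] with Ω(−π/2) = 1. Then Ω(π/2) = [[−cos(π/√2), −sin(π/√2)], [sin(π/√2), −cos(π/√2)]]. -/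
open Matrix Real

attribute [local instance] Matrix.normedAddCommGroup Matrix.normedSpace

/-- The ADHM matrix `Γ(t)` of the charge-1 instanton example:
`Γ(t) = [[cos t, 0, sin t, cos t], [0, cos t, -cos t, sin t]]`. -/
noncomputable def GammaADHM (t : ℝ) : Matrix (Fin 2) (Fin 4) ℂ :=
  !![(Real.cos t : ℂ), 0, (Real.sin t : ℂ), (Real.cos t : ℂ);
    0, (Real.cos t : ℂ), -(Real.cos t : ℂ), (Real.sin t : ℂ)]

/-- A primitive of `cos² / (1 + cos²)` vanishing at `-π/2`, smooth on the whole line. -/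
noncomputable def transportAngle (t : ℝ) : ℝ :=
  (t + π / 2) - (t + π / 2 + arctan ((1 / √2 - 1) * (sin t * cos t) /
    (cos t ^ 2 + 1 / √2 * sin t ^ 2))) / √2

lemma hasDerivAt_transportAngle (t : ℝ) :
    HasDerivAt transportAngle (cos t ^ 2 / (1 + cos t ^ 2)) t := by
  have hr : 0 < 1 / √2 := by positivity
  have hr2 : (1 / √2) ^ 2 = 1 / 2 := by rw [div_pow, Real.sq_sqrt (by norm_num)]; norm_num
  have heq : transportAngle = fun t => (t + π / 2) - (t + π / 2 +
      arctan ((1 / √2 - 1) * (sin t * cos t) / (cos t ^ 2 + 1 / √2 * sin t ^ 2))) * (1 / √2) := by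
    funext t
    simp only [transportAngle]
    ring
  rw [heq]
  generalize 1 / √2 = r at hr hr2
  have hsc := sin_sq_add_cos_sq t
  have hden : 0 < cos t ^ 2 + r * sin t ^ 2 := by
    rcases eq_or_ne (cos t) 0 with h | h
    · have : sin t ^ 2 = 1 := by rw [h] at hsc; linarith
      rw [this]; positivity
    · positivity
  have hnum := ((hasDerivAt_sin t).mul (hasDerivAt_cos t)).const_mul (r - 1)
  have hd := ((hasDerivAt_cos t).pow 2).add (((hasDerivAt_sin t).pow 2).const_mul r)
  have hq := (hnum.div hd hden.ne').arctan
  have hid := (hasDerivAt_id t).add_const (π / 2)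
  refine (hid.sub ((hid.add hq).mul_const r)).congr_deriv ?_
  simp only [Pi.mul_apply, Pi.add_apply, Pi.pow_apply, Pi.div_apply]
  have hs : sin t ^ 2 = 1 - cos t ^ 2 := by linarith
  have hpos : (cos t ^ 2 + r * sin t ^ 2) ^ 2 + ((r - 1) * (sin t * cos t)) ^ 2 =
      (1 + cos t ^ 2) / 2 := by
    have : (cos t ^ 2 + r * sin t ^ 2) ^ 2 + ((r - 1) * (sin t * cos t)) ^ 2 =
      (cos t ^ 2 + r ^ 2 * sin t ^ 2) * (sin t ^ 2 + cos t ^ 2) := by ring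
    rw [this, hsc, hr2, hs]; ring
  have hone : 1 + ((r - 1) * (sin t * cos t) / (cos t ^ 2 + r * sin t ^ 2)) ^ 2 =
      (1 + cos t ^ 2) / 2 / (cos t ^ 2 + r * sin t ^ 2) ^ 2 := by
    rw [← hpos]; field_simp
  have h1 : (1 + cos t ^ 2) ≠ 0 := by positivity
  rw [hone]
  push_cast
  have hcancel (x d : ℝ) (hd : 0 < d) :
      1 / ((1 + cos t ^ 2) / 2 / d ^ 2) * (x / d ^ 2) = 2 * x / (1 + cos t ^ 2) := by
    field_simp
  rw [hcancel _ _ hden, eq_div_iff h1, sub_mul, mul_right_comm, add_mul, div_mul_cancel₀ _ h1]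
  linear_combination (-2 * r * (r - 1) * (cos t ^ 2 - r * sin t ^ 2) - 2 * r ^ 2 * (1 - r)) * hsc
    + (-2 * (1 - r) * (1 - cos t ^ 2) - 2 * cos t ^ 2) * hr2

lemma transportAngle_neg_pi_div_two : transportAngle (-(π / 2)) = 0 := by
  simp [transportAngle]

lemma transportAngle_pi_div_two : transportAngle (π / 2) = π - π / √2 := by
  simp [transportAngle]

/-- The ODE `y' = -(c c' + c² J) / (1 + c²) y` with `c = cos` and `J = [[0, 1], [-1, 0]]`,
integrated from `-π/2` to `π/2`. -/
lemma transport_ode_endpoint {a b : ℝ → ℂ}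
    (ha : ∀ t ∈ Set.Icc (-(π / 2)) (π / 2), HasDerivWithinAt a
      ((cos t * sin t * a t - cos t ^ 2 * b t) / (1 + cos t ^ 2)) (Set.Icc (-(π / 2)) (π / 2)) t)
    (hb : ∀ t ∈ Set.Icc (-(π / 2)) (π / 2), HasDerivWithinAt b
      ((cos t * sin t * b t + cos t ^ 2 * a t) / (1 + cos t ^ 2)) (Set.Icc (-(π / 2)) (π / 2)) t) :
    a (π / 2) = -cos (π / √2) * a (-(π / 2)) - sin (π / √2) * b (-(π / 2)) ∧
    b (π / 2) = sin (π / √2) * a (-(π / 2)) - cos (π / √2) * b (-(π / 2)) := by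
  have hN (t : ℝ) : HasDerivAt (fun t => √(1 + cos t ^ 2))
      (-(cos t * sin t) / (1 + cos t ^ 2) * √(1 + cos t ^ 2)) t := by
    have h0 : 0 < 1 + cos t ^ 2 := by positivity
    refine ((((hasDerivAt_cos t).pow 2).const_add 1).sqrt h0.ne').congr_deriv ?_
    have hsq := Real.sq_sqrt h0.le
    have hp := Real.sqrt_pos.2 h0
    simp only [Pi.pow_apply]
    field_simp
    rw [hsq]
    norm_num
    left
    ring
  have hF (t : ℝ) (ht : t ∈ Set.Icc (-(π / 2)) (π / 2)) : HasDerivWithinAt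
      (fun t => (√(1 + cos t ^ 2) : ℂ) *
        ((cos (transportAngle t) : ℂ) * a t + (sin (transportAngle t) : ℂ) * b t)) 0
      (Set.Icc (-(π / 2)) (π / 2)) t := by
    have h0 : (1 + cos t ^ 2 : ℂ) ≠ 0 := by
      exact_mod_cast (by positivity : (1 + cos t ^ 2 : ℝ) ≠ 0)
    have hθ := hasDerivAt_transportAngle t
    refine ((hN t).ofReal_comp.hasDerivWithinAt.mul
      ((hθ.cos.ofReal_comp.hasDerivWithinAt.mul (ha t ht)).add
        (hθ.sin.ofReal_comp.hasDerivWithinAt.mul (hb t ht)))).congr_deriv ?_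
    simp only [Pi.mul_apply, Pi.add_apply]
    push_cast
    field_simp
    ring
  have hG (t : ℝ) (ht : t ∈ Set.Icc (-(π / 2)) (π / 2)) : HasDerivWithinAt
      (fun t => (√(1 + cos t ^ 2) : ℂ) *
        ((cos (transportAngle t) : ℂ) * b t - (sin (transportAngle t) : ℂ) * a t)) 0
      (Set.Icc (-(π / 2)) (π / 2)) t := by
    have h0 : (1 + cos t ^ 2 : ℂ) ≠ 0 := by
      exact_mod_cast (by positivity : (1 + cos t ^ 2 : ℝ) ≠ 0)
    have hθ := hasDerivAt_transportAngle t
    refine ((hN t).ofReal_comp.hasDerivWithinAt.mul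
      ((hθ.cos.ofReal_comp.hasDerivWithinAt.mul (hb t ht)).sub
        (hθ.sin.ofReal_comp.hasDerivWithinAt.mul (ha t ht)))).congr_deriv ?_
    simp only [Pi.mul_apply, Pi.sub_apply]
    push_cast
    field_simp
    ring
  have hpi := Real.pi_pos
  have hlt : -(π / 2) < π / 2 := by linarith
  have hconst {f : ℝ → ℂ} (hf : ∀ t ∈ Set.Icc (-(π / 2)) (π / 2),
      HasDerivWithinAt f 0 (Set.Icc (-(π / 2)) (π / 2)) t) : f (π / 2) = f (-(π / 2)) :=
    constant_of_derivWithin_zero (fun t ht => (hf t ht).differentiableWithinAt)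
      (fun t ht => (hf t (Set.Ico_subset_Icc_self ht)).derivWithin
        (uniqueDiffOn_Icc hlt t (Set.Ico_subset_Icc_self ht))) _ (Set.right_mem_Icc.2 hlt.le)
  have h1 := hconst hF
  have h2 := hconst hG
  have hsc : (sin (π / √2) : ℂ) ^ 2 + (cos (π / √2) : ℂ) ^ 2 = 1 := by
    exact_mod_cast sin_sq_add_cos_sq (π / √2)
  simp only [transportAngle_neg_pi_div_two, transportAngle_pi_div_two, Real.cos_pi_sub,
    Real.sin_pi_sub, Real.cos_pi_div_two, Real.cos_neg, Real.cos_zero, Real.sin_zero] at h1 h2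
  norm_num at h1 h2
  push_cast at hsc ⊢
  constructor
  · linear_combination (-a (π / 2)) * hsc - Complex.cos (π / √2) * h1 - Complex.sin (π / √2) * h2
  · linear_combination (-b (π / 2)) * hsc + Complex.sin (π / √2) * h1 - Complex.cos (π / √2) * h2

/-- Parallel transport along the rank-2 kernel subbundle of the ADHM matrix `Γ(t)`: if `v(t)`
is a smooth orthonormal frame of `ker Γ(t)` on `[-π/2, π/2]` with the standard frame at both
endpoints, and `Ω` solves `Ω' = -(vᴴ v') Ω` on `[-π/2, π/2]` with `Ω(-π/2) = 1`, then
`Ω(π/2) = [[-cos(π/√2), -sin(π/√2)], [sin(π/√2), -cos(π/√2)]]`. -/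
theorem instanton_example_parallel_transport
    (v : ℝ → Matrix (Fin 4) (Fin 2) ℂ)
    (hv : ContDiff ℝ (⊤ : ℕ∞) v)
    (hker : ∀ t ∈ Set.Icc (-(π / 2)) (π / 2), GammaADHM t * v t = 0)
    (horth : ∀ t ∈ Set.Icc (-(π / 2)) (π / 2), (v t)ᴴ * v t = 1)
    (hends : v (-(π / 2)) = !![1, 0; 0, 1; 0, 0; 0, 0] ∧
      v (π / 2) = !![1, 0; 0, 1; 0, 0; 0, 0])
    (Ω : ℝ → Matrix (Fin 2) (Fin 2) ℂ)
    (hΩ : ∀ t ∈ Set.Icc (-(π / 2)) (π / 2),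
      HasDerivWithinAt Ω (-((v t)ᴴ * deriv v t) * Ω t) (Set.Icc (-(π / 2)) (π / 2)) t)
    (hΩ0 : Ω (-(π / 2)) = 1) :
    Ω (π / 2) =
      !![(-Real.cos (π / Real.sqrt 2) : ℂ), (-Real.sin (π / Real.sqrt 2) : ℂ);
        (Real.sin (π / Real.sqrt 2) : ℂ), (-Real.cos (π / Real.sqrt 2) : ℂ)] := by
  have hpi := Real.pi_pos
  have hlt : -(π / 2) < π / 2 := by linarith
  set I := Set.Icc (-(π / 2)) (π / 2)
  set u : ℝ → Matrix (Fin 4) (Fin 2) ℂ := fun t => v t * Ω t with hu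
  set D : ℝ → Matrix (Fin 4) (Fin 2) ℂ := fun t =>
    deriv v t * Ω t + v t * (-((v t)ᴴ * deriv v t) * Ω t) with hD
  have hder (t : ℝ) (ht : t ∈ I) (i : Fin 4) (j : Fin 2) :
      HasDerivWithinAt (fun t => u t i j) (D t i j) I t := by
    have hvd : HasDerivWithinAt v (deriv v t) I t :=
      ((hv.differentiable (by simp)) t).hasDerivAt.hasDerivWithinAt
    have hve (k : Fin 2) : HasDerivWithinAt (fun t => v t i k) (deriv v t i k) I t :=
      hasDerivWithinAt_pi.1 (hasDerivWithinAt_pi.1 hvd i) k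
    have hΩe (k : Fin 2) := hasDerivWithinAt_pi.1 (hasDerivWithinAt_pi.1 (hΩ t ht) k) j
    simp only [hu, hD, Matrix.mul_apply (M := v _) (N := Ω _), Matrix.add_apply,
      Matrix.mul_apply (M := deriv v _) (N := Ω _), Matrix.mul_apply (M := v _),
      ← Finset.sum_add_distrib]
    exact HasDerivWithinAt.fun_sum fun k _ => (hve k).mul (hΩe k)
  -- the kernel of `Γ(t)` is the graph of `-cos t • Qᵀ`, where `Γ(t) = [cos t • 1 | Q]`
  let W : ℝ → Matrix (Fin 4) (Fin 2) ℂ := fun t =>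
    !![1, 0; 0, 1; -(cos t * sin t : ℂ), (cos t ^ 2 : ℂ); -(cos t ^ 2 : ℂ), -(cos t * sin t : ℂ)]
  have hsc (t : ℝ) : (sin t : ℂ) ^ 2 + (cos t : ℂ) ^ 2 = 1 := by
    exact_mod_cast sin_sq_add_cos_sq t
  have hker_graph (t : ℝ) (M : Matrix (Fin 4) (Fin 2) ℂ) (hM : GammaADHM t * M = 0) :
      M = W t * !![M 0 0, M 0 1; M 1 0, M 1 1] := by
    have hs := hsc t
    push_cast at hs
    have e0 (j : Fin 2) : Complex.cos t * M 0 j + Complex.sin t * M 2 j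
        + Complex.cos t * M 3 j = 0 := by
      simpa [GammaADHM, Matrix.mul_apply, Fin.sum_univ_four] using congrFun (congrFun hM 0) j
    have e1 (j : Fin 2) : Complex.cos t * M 1 j - Complex.cos t * M 2 j
        + Complex.sin t * M 3 j = 0 := by
      simpa [GammaADHM, Matrix.mul_apply, Fin.sum_univ_four, ← sub_eq_add_neg] using
        congrFun (congrFun hM 1) j
    have h2 (j : Fin 2) : M 2 j = -(cos t * sin t) * M 0 j + cos t ^ 2 * M 1 j := by
      push_cast
      linear_combination (-M 2 j) * hs + Complex.sin t * e0 j - Complex.cos t * e1 j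
    have h3 (j : Fin 2) : M 3 j = -(cos t ^ 2) * M 0 j - (cos t * sin t) * M 1 j := by
      push_cast
      linear_combination (-M 3 j) * hs + Complex.cos t * e0 j + Complex.sin t * e1 j
    ext i j
    fin_cases i <;> fin_cases j <;> simp [W, h2, h3, Matrix.mul_apply] <;> ring
  have hrow2 (t : ℝ) (ht : t ∈ I) (j : Fin 2) :
      u t 2 j = -(cos t * sin t) * u t 0 j + cos t ^ 2 * u t 1 j := by
    have := hker_graph t (u t) (by simp only [hu]; rw [← Matrix.mul_assoc, hker t ht, zero_mul])
    have := congrFun (congrFun this 2) j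
    rw [this]
    fin_cases j <;> simp [W, Matrix.mul_apply]
  have hrow3 (t : ℝ) (ht : t ∈ I) (j : Fin 2) :
      u t 3 j = -(cos t ^ 2) * u t 0 j - (cos t * sin t) * u t 1 j := by
    have := hker_graph t (u t) (by simp only [hu]; rw [← Matrix.mul_assoc, hker t ht, zero_mul])
    have := congrFun (congrFun this 3) j
    rw [this]
    fin_cases j <;> simp [W, Matrix.mul_apply] <;> ring
  have hWD (t : ℝ) (ht : t ∈ I) : (W t)ᴴ * D t = 0 := by
    have hvD : (v t)ᴴ * D t = 0 := by
      simp only [hD, Matrix.mul_add]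
      rw [← Matrix.mul_assoc (v t)ᴴ (v t), horth t ht]
      simp [Matrix.mul_assoc]
    have hx := hker_graph t (v t) (hker t ht)
    set x : Matrix (Fin 2) (Fin 2) ℂ := !![v t 0 0, v t 0 1; v t 1 0, v t 1 1]
    have hone : xᴴ * ((W t)ᴴ * (W t * x)) = 1 := by
      rw [← Matrix.mul_assoc, ← Matrix.conjTranspose_mul, ← hx, horth t ht]
    have hinv : ((W t)ᴴ * (W t * x)) * xᴴ = 1 := mul_eq_one_comm.1 hone
    rw [← Matrix.one_mul ((W t)ᴴ * D t), ← hinv, Matrix.mul_assoc, ← Matrix.mul_assoc xᴴ,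
      ← Matrix.conjTranspose_mul, ← hx, hvD, Matrix.mul_zero]
  have hcc (t : ℝ) := (hasDerivAt_cos t).ofReal_comp.hasDerivWithinAt (s := I)
  have hss (t : ℝ) := (hasDerivAt_sin t).ofReal_comp.hasDerivWithinAt (s := I)
  have hD2 (t : ℝ) (ht : t ∈ I) (j : Fin 2) :
      D t 2 j = (sin t ^ 2 - cos t ^ 2) * u t 0 j - 2 * (cos t * sin t) * u t 1 j
        - cos t * sin t * D t 0 j + cos t ^ 2 * D t 1 j := by
    have h := (((hcc t).mul (hss t)).neg.mul (hder t ht 0 j)).add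
      (((hcc t).pow 2).mul (hder t ht 1 j))
    have h' := (hder t ht 2 j).congr (fun s hs => (hrow2 s hs j).symm) (hrow2 t ht j).symm
    refine ((uniqueDiffOn_Icc hlt t ht).eq_deriv _ h' h).trans ?_
    simp
    ring
  have hD3 (t : ℝ) (ht : t ∈ I) (j : Fin 2) :
      D t 3 j = 2 * (cos t * sin t) * u t 0 j + (sin t ^ 2 - cos t ^ 2) * u t 1 j
        - cos t ^ 2 * D t 0 j - cos t * sin t * D t 1 j := by
    have h := (((hcc t).pow 2).neg.mul (hder t ht 0 j)).sub
      (((hcc t).mul (hss t)).mul (hder t ht 1 j))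
    have h' := (hder t ht 3 j).congr (fun s hs => (hrow3 s hs j).symm) (hrow3 t ht j).symm
    refine ((uniqueDiffOn_Icc hlt t ht).eq_deriv _ h' h).trans ?_
    simp
    ring
  have hode (t : ℝ) (ht : t ∈ I) (j : Fin 2) :
      D t 0 j = (cos t * sin t * u t 0 j - cos t ^ 2 * u t 1 j) / (1 + cos t ^ 2) ∧
      D t 1 j = (cos t * sin t * u t 1 j + cos t ^ 2 * u t 0 j) / (1 + cos t ^ 2) := by
    have h0 : (1 + cos t ^ 2 : ℂ) ≠ 0 := by
      exact_mod_cast (by positivity : (1 + cos t ^ 2 : ℝ) ≠ 0)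
    have e0 := congrFun (congrFun (hWD t ht) 0) j
    have e1 := congrFun (congrFun (hWD t ht) 1) j
    simp only [Matrix.mul_apply, Fin.sum_univ_four, Matrix.zero_apply,
      Matrix.conjTranspose_apply, hD2 t ht j, hD3 t ht j] at e0 e1
    simp [W, Complex.conj_ofReal, -Complex.ofReal_cos, -Complex.ofReal_sin] at e0 e1
    have hs : (sin t : ℂ) ^ 2 = 1 - (cos t : ℂ) ^ 2 := by linear_combination hsc t
    rw [eq_div_iff h0, eq_div_iff h0]
    generalize (cos t : ℂ) = c at *
    generalize (sin t : ℂ) = s at *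
    constructor
    · linear_combination e0 + (-(D t 0 j) * c ^ 2 + c * s * u t 0 j - c ^ 2 * u t 1 j) * hs
    · linear_combination e1 + (-(D t 1 j) * c ^ 2 + c * s * u t 1 j + c ^ 2 * u t 0 j) * hs
  have hval (j : Fin 2) := transport_ode_endpoint
    (fun t ht => (hode t ht j).1 ▸ hder t ht 0 j) (fun t ht => (hode t ht j).2 ▸ hder t ht 1 j)
  simp only [hu, hends.1, hends.2, hΩ0] at hval
  have h0 := hval 0
  have h1 := hval 1
  simp [Matrix.mul_apply, Fin.sum_univ_two] at h0 h1
  ext i j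
  fin_cases i <;> fin_cases j <;> simp [h0, h1]
end
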